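/- arXiv:2404.13394 — 2 statements merged into one kernel-verified Lean document; each statement's English description precedes it below -/
import Mathlib

section
/- For every commutative ring R with identity, the small finitistic dimension of R equals the supremum, taken over all maximal ideals 𝔪 of R, of the grades grade_R(𝔪, R); that is, fPD(R) = sup{ grade_R(𝔪, R) : 𝔪 ∈ Max(R) } in ℕ ∪ {∞}. -/
open CategoryTheory

universe u

/-- `M` has a projective resolution `0 → P_n → ⋯ → P_0 → M → 0` of length at most `n`
(the `P_i` projective, not necessarily finitely generated). -/
def HasProjResLE (R : Type u) [CommRing R] :
    ℕ → ∀ (M : Type u) [AddCommGroup M] [Module R M], Prop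
  | 0, M, _, _ => Module.Projective R M
  | n + 1, M, _, _ => ∃ (P : Type u) (_ : AddCommGroup P) (_ : Module R P) (f : P →ₗ[R] M),
      Module.Projective R P ∧ Function.Surjective f ∧ HasProjResLE R n (LinearMap.ker f)

/-- `M` has a finite projective resolution `0 → P_n → ⋯ → P_0 → M → 0` of length `n`
with each `P_i` finitely generated projective. -/
def HasFPRLen (R : Type u) [CommRing R] :
    ℕ → ∀ (M : Type u) [AddCommGroup M] [Module R M], Prop
  | 0, M, _, _ => Module.Finite R M ∧ Module.Projective R M
  | n + 1, M, _, _ => ∃ (P : Type u) (_ : AddCommGroup P) (_ : Module R P) (f : P →ₗ[R] M),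
      Module.Finite R P ∧ Module.Projective R P ∧ Function.Surjective f ∧
        HasFPRLen R n (LinearMap.ker f)

/-- `M` has a finite projective resolution by finitely generated projectives. -/
def HasFPR (R : Type u) [CommRing R] (M : Type u) [AddCommGroup M] [Module R M] : Prop :=
  ∃ n, HasFPRLen R n M

/-- The projective dimension of `M`, as an element of `ℕ∞` (with `⊤` meaning no finite
projective resolution exists). -/
noncomputable def projDim (R : Type u) [CommRing R] (M : Type u) [AddCommGroup M]
    [Module R M] : ℕ∞ :=
  sInf {n : ℕ∞ | ∃ m : ℕ, n = m ∧ HasProjResLE R m M}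

/-- The small finitistic dimension `fPD R`: the supremum, in `ℕ∞`, of the projective
dimensions of `R`-modules having a finite projective resolution. -/
noncomputable def fPD (R : Type u) [CommRing R] : ℕ∞ :=
  ⨆ (M : ModuleCat.{u} R) (_ : HasFPR R M), projDim R M

/-- `Ext_R^n(M, N)` as an `R`-module (object of `ModuleCat R`). -/
noncomputable def ExtMod (R : Type u) [CommRing R] (M N : Type u) [AddCommGroup M] [Module R M]
    [AddCommGroup N] [Module R N] (n : ℕ) : ModuleCat.{u} R :=
  ((Ext R (ModuleCat.{u} R) n).obj (Opposite.op (ModuleCat.of R M))).obj (ModuleCat.of R N)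

/-- The Ext-grade of an ideal `I` on `M`: `inf { p | Ext_R^p(R/I, M) ≠ 0 } ∈ ℕ∞`. -/
noncomputable def extGrade (R : Type u) [CommRing R] (I : Ideal R) (M : Type u) [AddCommGroup M]
    [Module R M] : ℕ∞ :=
  sInf {n : ℕ∞ | ∃ p : ℕ, n = p ∧ ¬ Subsingleton (ExtMod R (R ⧸ I) M p)}

/-- The grade of an arbitrary ideal `J` on `M`: the supremum of the Ext-grades of the
finitely generated ideals contained in `J`. -/
noncomputable def idealGrade (R : Type u) [CommRing R] (J : Ideal R) (M : Type u)
    [AddCommGroup M] [Module R M] : ℕ∞ :=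
  ⨆ (I : Ideal R) (_ : I.FG) (_ : I ≤ J), extGrade R I M

open Limits

section ExtComparison

/-- The `Ext` modules defined by left derived functors and the `Ext` groups defined by the
derived category vanish simultaneously. -/
lemma subsingleton_extMod_iff (R : Type u) [CommRing R] (M N : Type u) [AddCommGroup M]
    [Module R M] [AddCommGroup N] [Module R N] (n : ℕ) :
    Subsingleton (ExtMod R M N n) ↔
      Subsingleton (Abelian.Ext (ModuleCat.of R M) (ModuleCat.of R N) n) := by
  let P := projectiveResolution (ModuleCat.of R M)
  let Y := ModuleCat.of R N
  have hiso := (P.isoExt (R := R) n Y).isZero_iff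
  have h0 : Subsingleton (ExtMod R M N n) ↔ IsZero (ExtMod R M N n) :=
    ModuleCat.isZero_iff_subsingleton.symm
  rw [h0]
  refine hiso.trans ?_
  rw [← HomologicalComplex.exactAt_iff_isZero_homology]
  cases n with
  | zero =>
    rw [HomologicalComplex.exactAt_iff' _ 0 0 1 (by simp) (by simp),
      ShortComplex.moduleCat_exact_iff, Abelian.Ext.homEquiv₀.subsingleton_congr]
    obtain ⟨π, hπ, hepi, hdesc⟩ : ∃ π : P.complex.X 0 ⟶ ModuleCat.of R M,
        P.complex.d 1 0 ≫ π = 0 ∧ Epi π ∧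
        ∀ f : P.complex.X 0 ⟶ Y, P.complex.d 1 0 ≫ f = 0 → ∃ k, π ≫ k = f :=
      ⟨P.π.f 0, P.complex_d_comp_π_f_zero, inferInstanceAs (Epi (P.π.f 0)),
        fun f hf => ⟨P.exact₀.desc f hf, P.exact₀.g_desc f hf⟩⟩
    constructor
    · intro h
      refine subsingleton_of_forall_eq 0 fun f => ?_
      obtain ⟨(g : P.complex.X 0 ⟶ Y), (hg : P.complex.d 0 0 ≫ g = π ≫ f)⟩ := h (π ≫ f) (by
        change P.complex.d 1 0 ≫ π ≫ f = 0
        rw [← Category.assoc, hπ, zero_comp])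
      rw [P.complex.shape 0 0 (by simp), zero_comp] at hg
      rw [← cancel_epi π, ← hg, comp_zero]
    · intro h f hf
      obtain ⟨k, hk⟩ := hdesc f hf
      refine ⟨0, (map_zero _).trans ?_⟩
      rw [← hk, h.elim k 0, comp_zero]
      rfl
  | succ p =>
    rw [HomologicalComplex.exactAt_iff' _ p (p + 1) (p + 2) (by simp) (by simp),
      ShortComplex.moduleCat_exact_iff]
    constructor
    · intro h
      refine subsingleton_of_forall_eq 0 fun x => ?_
      obtain ⟨f, hf, rfl⟩ := P.extMk_surjective x (p + 2) rfl
      obtain ⟨g, hg⟩ := h f hf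
      exact (P.extMk_eq_zero_iff f (p + 2) rfl hf p rfl).2 ⟨g, hg⟩
    · intro h f hf
      exact (P.extMk_eq_zero_iff f (p + 2) rfl hf p rfl).1 (Subsingleton.elim _ _)

end ExtComparison

section FiniteProjectiveResolutions

variable {R : Type u} [CommRing R]

lemma HasFPRLen.of_equiv {n : ℕ} {M N : Type u} [AddCommGroup M] [Module R M] [AddCommGroup N]
    [Module R N] (e : M ≃ₗ[R] N) (h : HasFPRLen R n M) : HasFPRLen R n N := by
  cases n with
  | zero =>
    obtain ⟨_, _⟩ := h
    exact ⟨Module.Finite.equiv e, Module.Projective.of_equiv e⟩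
  | succ n =>
    obtain ⟨P, _, _, f, hfin, hproj, hf, hker⟩ := h
    refine ⟨P, _, _, e.toLinearMap ∘ₗ f, hfin, hproj, e.surjective.comp hf, ?_⟩
    rwa [LinearEquiv.ker_comp]

lemma HasFPRLen.succ {n : ℕ} {M : Type u} [AddCommGroup M] [Module R M]
    (h : HasFPRLen R n M) : HasFPRLen R (n + 1) M := by
  induction n generalizing M with
  | zero =>
    refine ⟨M, _, _, LinearMap.id, h.1, h.2, Function.surjective_id, ?_⟩
    rw [LinearMap.ker_id]
    exact ⟨inferInstance, inferInstance⟩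
  | succ n ih =>
    obtain ⟨P, _, _, f, hfin, hproj, hf, hker⟩ := h
    exact ⟨P, _, _, f, hfin, hproj, hf, ih hker⟩

/-- The horseshoe lemma for resolutions by finitely generated projective modules. -/
lemma HasFPRLen.of_exact {n : ℕ} {A B C : Type u} [AddCommGroup A] [Module R A]
    [AddCommGroup B] [Module R B] [AddCommGroup C] [Module R C] {i : A →ₗ[R] B} {p : B →ₗ[R] C}
    (hi : Function.Injective i) (hip : Function.Exact i p) (hp : Function.Surjective p)
    (hA : HasFPRLen R n A) (hC : HasFPRLen R n C) : HasFPRLen R n B := by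
  induction n generalizing A B C with
  | zero =>
    obtain ⟨_, _⟩ := hA
    obtain ⟨_, _⟩ := hC
    obtain ⟨s, hs⟩ := Module.projective_lifting_property p LinearMap.id hp
    have hs' (c : C) : p (s c) = c := LinearMap.congr_fun hs c
    have hbij : Function.Bijective (i.coprod s) := by
      constructor
      · rw [injective_iff_map_eq_zero]
        rintro ⟨a, c⟩ h
        rw [LinearMap.coprod_apply] at h
        have hc : c = 0 := by simpa [hip.apply_apply_eq_zero, hs'] using congrArg p h
        subst hc
        simpa [hi.eq_iff' (map_zero i)] using h
      · intro b
        obtain ⟨a, ha⟩ := (hip (b - s (p b))).1 (by simp [hs'])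
        exact ⟨(a, p b), by simp [ha]⟩
    exact HasFPRLen.of_equiv (n := 0) (LinearEquiv.ofBijective _ hbij)
      ⟨inferInstance, inferInstance⟩
  | succ n ih =>
    obtain ⟨P, _, _, f, _, _, hf, hkf⟩ := hA
    obtain ⟨Q, _, _, g, _, _, hg, hkg⟩ := hC
    obtain ⟨s, hs⟩ := Module.projective_lifting_property p g hp
    have hs' (q : Q) : p (s q) = g q := LinearMap.congr_fun hs q
    let t : P × Q →ₗ[R] B := (i ∘ₗ f).coprod s
    have htmem (x : P × Q) (hx : x ∈ LinearMap.ker t) : g x.2 = 0 := by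
      have h : i (f x.1) + s x.2 = 0 := hx
      simpa [hip.apply_apply_eq_zero, hs'] using congrArg p h
    refine ⟨P × Q, _, _, t, inferInstance, inferInstance, ?_, ?_⟩
    · intro b
      obtain ⟨q, hq⟩ := hg (p b)
      obtain ⟨a, ha⟩ := (hip (b - s q)).1 (by simp [hs', hq])
      obtain ⟨x, rfl⟩ := hf a
      exact ⟨(x, q), by simp [t, ha]⟩
    · let i' : LinearMap.ker f →ₗ[R] LinearMap.ker t :=
        (LinearMap.inl R P Q).restrict fun x hx => by
          have : f x = 0 := hx
          simp [t, this]
      let p' : LinearMap.ker t →ₗ[R] LinearMap.ker g := (LinearMap.snd R P Q).restrict htmem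
      refine ih (i := i') (p := p') ?_ ?_ ?_ hkf hkg
      · intro x y h
        exact Subtype.ext (congrArg (fun z => z.1.1) h)
      · rintro ⟨⟨x, q⟩, h⟩
        constructor
        · intro h0
          have hq : q = 0 := congrArg Subtype.val h0
          subst hq
          have hx : f x = 0 := by
            simpa [t, hi.eq_iff' (map_zero i)] using h
          exact ⟨⟨x, hx⟩, rfl⟩
        · rintro ⟨y, hy⟩
          exact Subtype.ext (congrArg (fun z => z.1.2) hy).symm
      · rintro ⟨q, hq⟩
        have hq0 : g q = 0 := hq
        obtain ⟨a, ha⟩ := (hip (s q)).1 (by rw [hs', hq0])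
        obtain ⟨x, rfl⟩ := hf a
        exact ⟨⟨(-x, q), by simp [t, ha]⟩, rfl⟩

/-- The mapping cone of an injective map of modules with finite projective resolutions. -/
lemma HasFPRLen.of_exact_right {n : ℕ} {A B C : Type u} [AddCommGroup A] [Module R A]
    [AddCommGroup B] [Module R B] [AddCommGroup C] [Module R C] {i : A →ₗ[R] B} {p : B →ₗ[R] C}
    (hi : Function.Injective i) (hip : Function.Exact i p) (hp : Function.Surjective p)
    (hA : HasFPRLen R n A) (hB : HasFPRLen R n B) : HasFPRLen R (n + 1) C := by
  obtain ⟨P, _, _, f, _, _, hf, hker⟩ := hB.succ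
  refine ⟨P, _, _, p ∘ₗ f, ‹_›, ‹_›, hp.comp hf, ?_⟩
  let e : A ≃ₗ[R] LinearMap.ker p :=
    (LinearEquiv.ofInjective i hi).trans (LinearEquiv.ofEq _ _ (LinearMap.exact_iff.1 hip).symm)
  let i' : LinearMap.ker f →ₗ[R] LinearMap.ker (p ∘ₗ f) :=
    Submodule.inclusion (LinearMap.ker_le_ker_comp f p)
  let p' : LinearMap.ker (p ∘ₗ f) →ₗ[R] LinearMap.ker p := f.restrict fun x hx => hx
  refine HasFPRLen.of_exact (i := i') (p := p') (Submodule.inclusion_injective _) ?_ ?_ hker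
    (hA.of_equiv e)
  · rintro ⟨x, hx⟩
    constructor
    · intro h
      exact ⟨⟨x, congrArg Subtype.val h⟩, rfl⟩
    · rintro ⟨y, hy⟩
      refine Subtype.ext ?_
      have : y.1 = x := congrArg Subtype.val hy
      change f x = 0
      rw [← this]
      exact y.2
  · rintro ⟨b, hb⟩
    obtain ⟨x, rfl⟩ := hf b
    exact ⟨⟨x, hb⟩, rfl⟩

lemma HasFPRLen.pi {n : ℕ} {M : Type u} [AddCommGroup M] [Module R M] (k : ℕ)
    (h : HasFPRLen R n M) : HasFPRLen R n (Fin k → M) := by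
  induction n generalizing M with
  | zero =>
    obtain ⟨_, _⟩ := h
    exact ⟨inferInstance, Module.Projective.of_equiv DFinsupp.linearEquivFunOnFintype⟩
  | succ n ih =>
    obtain ⟨P, _, _, f, _, _, hf, hker⟩ := h
    have : Module.Projective R (Fin k → P) :=
      Module.Projective.of_equiv DFinsupp.linearEquivFunOnFintype
    refine ⟨Fin k → P, _, _, f.compLeft (Fin k), inferInstance, this,
      hf.comp_left, ?_⟩
    let j : (Fin k → LinearMap.ker f) →ₗ[R] LinearMap.ker (f.compLeft (Fin k)) :=
      ((LinearMap.ker f).subtype.compLeft (Fin k)).codRestrict _ fun x =>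
        funext fun a => (x a).2
    refine HasFPRLen.of_equiv (LinearEquiv.ofBijective j ⟨?_, ?_⟩) (ih hker)
    · intro x y h
      exact funext fun a => Subtype.ext (congrFun (congrArg Subtype.val h) a)
    · rintro ⟨x, hx⟩
      exact ⟨fun a => ⟨x a, congrFun hx a⟩, rfl⟩

lemma HasFPRLen.hasProjResLE {n : ℕ} {M : Type u} [AddCommGroup M] [Module R M]
    (h : HasFPRLen R n M) : HasProjResLE R n M := by
  induction n generalizing M with
  | zero => exact h.2
  | succ n ih =>
    obtain ⟨P, _, _, f, _, hproj, hf, hker⟩ := h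
    exact ⟨P, _, _, f, hproj, hf, ih hker⟩

lemma HasProjResLE.hasProjectiveDimensionLT {n : ℕ} {M : Type u} [AddCommGroup M] [Module R M]
    (h : HasProjResLE R n M) : HasProjectiveDimensionLT (ModuleCat.of R M) (n + 1) := by
  induction n generalizing M with
  | zero =>
    have : Module.Projective R M := h
    infer_instance
  | succ n ih =>
    obtain ⟨P, _, _, f, hproj, hf, hker⟩ := h
    exact (LinearMap.shortExact_shortComplexKer hf).hasProjectiveDimensionLT_X₃ (n + 1)
      (ih hker) (hasProjectiveDimensionLT_of_ge (ModuleCat.of R P) 1 _ (by omega))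

lemma le_projDim_of_not_subsingleton_ext {k : ℕ} {M : Type u} [AddCommGroup M] [Module R M]
    {N : ModuleCat.{u} R} (h : ¬ Subsingleton (Abelian.Ext (ModuleCat.of R M) N k)) :
    (k : ℕ∞) ≤ projDim R M := by
  refine le_sInf ?_
  rintro _ ⟨m, rfl, hm⟩
  by_contra! hlt
  have := hm.hasProjectiveDimensionLT
  exact h (HasProjectiveDimensionLT.subsingleton _ (m + 1) k (by exact_mod_cast hlt) N)

end FiniteProjectiveResolutions

section ExtVanishing

open Abelian

variable {R : Type u} [CommRing R]

lemma ext_smul_eq_zero_of_left {X : ModuleCat.{u} R} {r : R} (hr : r • 𝟙 X = 0)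
    {Y : ModuleCat.{u} R} {n : ℕ} (x : Ext X Y n) : r • x = 0 := by
  rw [← Ext.mk₀_id_comp x, ← Ext.smul_comp, ← Ext.mk₀_smul, hr, Ext.mk₀_zero, Ext.zero_comp]

lemma ext_smul_eq_zero_of_right {Y : ModuleCat.{u} R} {r : R} (hr : r • 𝟙 Y = 0)
    {X : ModuleCat.{u} R} {n : ℕ} (x : Ext X Y n) : r • x = 0 := by
  rw [Ext.smul_eq_comp_mk₀, hr, Ext.mk₀_zero, Ext.comp_zero]

lemma smul_id_quotient_eq_zero {I : Ideal R} {r : R} (hr : r ∈ I) :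
    r • 𝟙 (ModuleCat.of R (R ⧸ I)) = 0 := by
  ext
  change r • (1 : R ⧸ I) = 0
  rw [Algebra.smul_def, mul_one]
  exact Ideal.Quotient.eq_zero_iff_mem.2 hr

/-- If the identity of `B` is a finite sum of maps factoring through `A`, then `Ext` groups with
values in `B` vanish whenever those with values in `A` do. -/
lemma subsingleton_ext_of_sum_comp_eq_id {X : ModuleCat.{u} R} {n : ℕ} {A B : Type u}
    [AddCommGroup A] [Module R A] [AddCommGroup B] [Module R B] {ι : Type*} [Fintype ι]
    (a : ι → A →ₗ[R] B) (b : ι → B →ₗ[R] A) (hab : ∀ y, ∑ i, a i (b i y) = y)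
    (h : Subsingleton (Ext X (ModuleCat.of R A) n)) :
    Subsingleton (Ext X (ModuleCat.of R B) n) := by
  refine subsingleton_of_forall_eq 0 fun x => ?_
  have hid : 𝟙 (ModuleCat.of R B) = ∑ i, ModuleCat.ofHom (b i) ≫ ModuleCat.ofHom (a i) := by
    ext y
    simp [hab]
  rw [← Ext.comp_mk₀_id x, hid, Ext.mk₀_sum, Ext.comp_sum]
  refine Finset.sum_eq_zero fun i _ => ?_
  rw [← Ext.mk₀_comp_mk₀, ← Ext.comp_assoc_of_third_deg_zero, h.elim (x.comp _ _) 0, Ext.zero_comp]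

lemma exists_dual_basis (P : Type u) [AddCommGroup P] [Module R P] [Module.Finite R P]
    [Module.Projective R P] : ∃ (n : ℕ) (e : Fin n → P) (φ : Fin n → P →ₗ[R] R),
      ∀ y, ∑ i, φ i y • e i = y := by
  obtain ⟨n, f, g, -, -, hfg⟩ := Module.Finite.exists_comp_eq_id_of_projective R P
  refine ⟨n, fun i => f (Pi.single i 1), fun i => LinearMap.proj i ∘ₗ g, fun y => ?_⟩
  conv_rhs => rw [← LinearMap.id_apply (R := R) y, ← hfg]
  simp only [LinearMap.comp_apply, LinearMap.proj_apply, ← map_smul, ← map_sum]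
  congr 1
  ext j
  simp [Finset.sum_apply, Pi.single_apply]

lemma subsingleton_ext_of_finite_projective {X : ModuleCat.{u} R} {n : ℕ} (P : Type u)
    [AddCommGroup P] [Module R P] [Module.Finite R P] [Module.Projective R P]
    (h : Subsingleton (Ext X (ModuleCat.of R R) n)) :
    Subsingleton (Ext X (ModuleCat.of R P) n) := by
  obtain ⟨k, e, φ, he⟩ := exists_dual_basis (R := R) P
  exact subsingleton_ext_of_sum_comp_eq_id (fun i => LinearMap.toSpanSingleton R P (e i)) φ
    (by simpa using he) h

lemma subsingleton_ext_pi {X : ModuleCat.{u} R} {n : ℕ} (M : Type u) [AddCommGroup M]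
    [Module R M] (k : ℕ) (h : Subsingleton (Ext X (ModuleCat.of R M) n)) :
    Subsingleton (Ext X (ModuleCat.of R (Fin k → M)) n) :=
  subsingleton_ext_of_sum_comp_eq_id (fun i => LinearMap.single R (fun _ : Fin k => M) i)
    (fun i => LinearMap.proj i) (fun y => by simp [LinearMap.single_apply, Finset.univ_sum_single]) h

/-- The groups `Ext_R^i(R/I, M)` vanish for all `i < d`. -/
def ExtVanishesBelow (I : Ideal R) (M : Type u) [AddCommGroup M] [Module R M] (d : ℕ) : Prop :=
  ∀ i < d, Subsingleton (Ext (ModuleCat.of R (R ⧸ I)) (ModuleCat.of R M) i)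

lemma le_extGrade_iff {I : Ideal R} {M : Type u} [AddCommGroup M] [Module R M] {d : ℕ} :
    (d : ℕ∞) ≤ extGrade R I M ↔ ExtVanishesBelow I M d := by
  constructor
  · intro h i hi
    by_contra hne
    rw [← subsingleton_extMod_iff] at hne
    have : (d : ℕ∞) ≤ i := h.trans (sInf_le ⟨i, rfl, hne⟩)
    exact absurd (by exact_mod_cast this) hi.not_ge
  · intro h
    refine le_sInf ?_
    rintro _ ⟨p, rfl, hp⟩
    rw [subsingleton_extMod_iff] at hp
    by_contra! hlt
    exact hp (h p (by exact_mod_cast hlt))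

end ExtVanishing

section GradeLeFPD

open Abelian

variable {R : Type u} [CommRing R]

lemma ExtVanishesBelow.eq_zero_of_forall_smul_eq_zero {I : Ideal R} {M : Type u} [AddCommGroup M]
    [Module R M] {d : ℕ} (h : ExtVanishesBelow I M (d + 1)) {y : M} (hy : ∀ r ∈ I, r • y = 0) :
    y = 0 := by
  have h0 := h 0 d.succ_pos
  rw [Ext.homEquiv₀.subsingleton_congr] at h0
  let f : (R ⧸ I) →ₗ[R] M := I.liftQ (LinearMap.toSpanSingleton R M y) hy
  have hf : ModuleCat.ofHom f = 0 := h0.elim _ _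
  have hf1 : f 1 = 0 := by
    rw [← ModuleCat.hom_ofHom f, hf]
    rfl
  have hfy : f 1 = (1 : R) • y := rfl
  rwa [hf1, one_smul, eq_comm] at hfy

/-- Multiplication by a family of elements of `R`, as a map from `M` to a finite power of `M`. -/
def smulPi {n : ℕ} (x : Fin n → R) (M : Type u) [AddCommGroup M] [Module R M] :
    M →ₗ[R] (Fin n → M) :=
  LinearMap.pi fun j => x j • LinearMap.id

lemma shortExact_smulPi {n : ℕ} {x : Fin n → R} {M : Type u} [AddCommGroup M] [Module R M]
    (h : Function.Injective (smulPi x M)) :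
    (ShortComplex.mk (ModuleCat.ofHom (smulPi x M))
      (ModuleCat.ofHom (LinearMap.range (smulPi x M)).mkQ)
      (by ext1; exact LinearMap.range_mkQ_comp _)).ShortExact :=
  ModuleCat.shortComplex_shortExact _ (LinearMap.exact_map_mkQ_range _) h
    (Submodule.mkQ_surjective _)

lemma exists_hasFPRLen_not_subsingleton_ext {n : ℕ} (x : Fin n → R) {m : Ideal R}
    (hx : ∀ j, x j ∈ m) (k : ℕ) {l : ℕ} {M : Type u} [AddCommGroup M] [Module R M]
    (hM : HasFPRLen R l M)
    (hext : ¬ Subsingleton (Ext (ModuleCat.of R M) (ModuleCat.of R (R ⧸ m)) l))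
    (hgr : ExtVanishesBelow (Ideal.span (Set.range x)) M k) :
    ∃ N : ModuleCat.{u} R, HasFPR R N ∧
      ¬ Subsingleton (Ext N (ModuleCat.of R (R ⧸ m)) (l + k)) := by
  induction k generalizing l M with
  | zero => exact ⟨ModuleCat.of R M, ⟨l, hM⟩, hext⟩
  | succ k ih =>
    have hinj : Function.Injective (smulPi x M) := by
      rw [injective_iff_map_eq_zero]
      intro y hy
      refine hgr.eq_zero_of_forall_smul_eq_zero fun r hr => ?_
      have hle : Ideal.span (Set.range x) ≤ LinearMap.ker (LinearMap.toSpanSingleton R M y) := by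
        refine Ideal.span_le.2 ?_
        rintro _ ⟨j, rfl⟩
        exact congrFun hy j
      exact hle hr
    have hS := shortExact_smulPi hinj
    have hC := HasFPRLen.of_exact_right hinj (LinearMap.exact_map_mkQ_range _)
      (Submodule.mkQ_surjective _) hM (hM.pi n)
    have hextC : ¬ Subsingleton (Ext (ModuleCat.of R
        ((Fin n → M) ⧸ LinearMap.range (smulPi x M))) (ModuleCat.of R (R ⧸ m)) (l + 1)) := by
      intro hsub
      refine hext (subsingleton_of_forall_eq 0 fun y => ?_)
      obtain ⟨z, rfl⟩ := Ext.contravariant_sequence_exact₁ hS _ y (add_comm 1 l) (hsub.elim _ _)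
      have hsum : ModuleCat.ofHom (smulPi x M) =
          ∑ j, x j • ModuleCat.ofHom (LinearMap.single R (fun _ : Fin n => M) j) := by
        ext y j
        simp [smulPi, Finset.sum_apply, Pi.single_apply]
      change (Ext.mk₀ (ModuleCat.ofHom (smulPi x M))).comp z _ = 0
      rw [hsum, Ext.mk₀_sum, Ext.sum_comp]
      refine Finset.sum_eq_zero fun j _ => ?_
      rw [Ext.mk₀_smul, Ext.smul_comp]
      exact ext_smul_eq_zero_of_right (smul_id_quotient_eq_zero (hx j)) _
    have hgrC : ExtVanishesBelow (Ideal.span (Set.range x))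
        ((Fin n → M) ⧸ LinearMap.range (smulPi x M)) k := by
      intro i hi
      refine subsingleton_of_forall_eq 0 fun y => ?_
      obtain ⟨z, rfl⟩ := Ext.covariant_sequence_exact₃ _ hS y rfl
        ((hgr (i + 1) (by omega)).elim _ _)
      rw [(subsingleton_ext_pi M n (hgr i (by omega))).elim z 0, Ext.zero_comp]
    obtain ⟨N, hN, hne⟩ := ih hC hextC hgrC
    refine ⟨N, hN, ?_⟩
    rwa [add_assoc, add_comm 1 k] at hne

lemma le_fPD_of_extVanishesBelow {I m : Ideal R} (hI : I.FG) (hm : m.IsMaximal) (hIm : I ≤ m)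
    {k : ℕ} (hk : ExtVanishesBelow I R k) : (k : ℕ∞) ≤ fPD R := by
  obtain ⟨n, x, rfl⟩ := Submodule.fg_iff_exists_fin_generating_family.1 hI
  have hx (j) : x j ∈ m := hIm (Ideal.subset_span ⟨j, rfl⟩)
  have hR : HasFPRLen R 0 R := ⟨inferInstance, inferInstance⟩
  have hext : ¬ Subsingleton (Ext (ModuleCat.of R R) (ModuleCat.of R (R ⧸ m)) 0) := by
    rw [Ext.homEquiv₀.subsingleton_congr]
    intro h
    have h1 : m.mkQ (1 : R) = 0 :=
      LinearMap.congr_fun (congrArg ModuleCat.Hom.hom (h.elim (ModuleCat.ofHom m.mkQ) 0)) 1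
    exact hm.ne_top ((Ideal.eq_top_iff_one m).2 ((Submodule.Quotient.mk_eq_zero m).1 h1))
  obtain ⟨N, hN, hne⟩ := exists_hasFPRLen_not_subsingleton_ext x hx k hR hext hk
  rw [zero_add] at hne
  exact (le_projDim_of_not_subsingleton_ext hne).trans (le_iSup₂_of_le N hN le_rfl)

end GradeLeFPD

section FPDLeGrade

open Abelian

variable {R : Type u} [CommRing R]

/-- A map of finitely generated projective modules which is not a split injection kills a
unimodular vector modulo some maximal ideal. -/
lemma exists_leftInverse_or_exists_maximal {P Q : Type u} [AddCommGroup P] [Module R P]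
    [Module.Finite R P] [Module.Projective R P] [AddCommGroup Q] [Module R Q] (f : P →ₗ[R] Q) :
    (∃ g : Q →ₗ[R] P, g ∘ₗ f = LinearMap.id) ∨
      ∃ (m : Ideal R) (_ : m.IsMaximal) (e : P) (φ : P →ₗ[R] R),
        φ e ∉ m ∧ ∀ ψ : Q →ₗ[R] R, ψ (f e) ∈ m := by
  obtain ⟨n, b, φ, hb⟩ := exists_dual_basis (R := R) P
  by_cases htop : LinearMap.range f.dualMap = ⊤
  · left
    rw [LinearMap.range_eq_top] at htop
    choose ψ hψ using fun i => htop (φ i)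
    refine ⟨∑ i, (ψ i).smulRight (b i), LinearMap.ext fun y => ?_⟩
    have hψ' (i) : ψ i (f y) = φ i y := LinearMap.congr_fun (hψ i) y
    simp [hψ', hb]
  · right
    obtain ⟨N, hN, hle⟩ := (eq_top_or_exists_le_coatom _).resolve_left htop
    obtain ⟨m, hm, ⟨t⟩⟩ := isSimpleModule_iff_quot_maximal.1 (isSimpleModule_iff_isCoatom.2 hN)
    let v : Module.Dual R P →ₗ[R] R ⧸ m := t.toLinearMap ∘ₗ N.mkQ
    have hv (χ : Module.Dual R P) : v χ = 0 ↔ χ ∈ N := by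
      simp [v]
    choose c hc using fun i => Ideal.Quotient.mk_surjective (v (φ i))
    have hpair (χ : Module.Dual R P) : Ideal.Quotient.mk m (χ (∑ i, c i • b i)) = v χ := by
      have hχ : χ = ∑ i, χ (b i) • φ i := by
        ext y
        conv_lhs => rw [← hb y]
        simp [mul_comm]
      conv_rhs => rw [hχ]
      simp [map_sum, ← hc, Algebra.smul_def, mul_comm]
    have hmem (χ : Module.Dual R P) : χ (∑ i, c i • b i) ∈ m ↔ χ ∈ N := by
      rw [← hv, ← hpair, Ideal.Quotient.eq_zero_iff_mem]
    obtain ⟨χ, hχ⟩ : ∃ χ, χ ∉ N := by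
      by_contra! hall
      exact hN.1 (eq_top_iff.2 fun χ _ => hall χ)
    exact ⟨m, hm, ∑ i, c i • b i, χ, fun h => hχ ((hmem χ).1 h),
      fun ψ => (hmem (f.dualMap ψ)).2 (hle ⟨ψ, rfl⟩)⟩

/-- With respect to the vanishing of `Ext_R^i(R/I, -)`, the module `M` behaves like a `j`-th
syzygy. -/
def IsExtSyzygy (R : Type u) [CommRing R] (j : ℕ) (M : Type u) [AddCommGroup M] [Module R M] :
    Prop :=
  ∀ (I : Ideal R) (d : ℕ), ExtVanishesBelow I R d → ExtVanishesBelow I M (min j d)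

lemma IsExtSyzygy.zero {M : Type u} [AddCommGroup M] [Module R M] : IsExtSyzygy R 0 M :=
  fun _ _ _ _ hi => absurd hi (by simp)

lemma ext_postcomp_ker_subtype_eq_zero {P M : Type u} [AddCommGroup P] [Module R P]
    [AddCommGroup M] [Module R M] {f : P →ₗ[R] M} (hf : Function.Surjective f)
    {X : ModuleCat.{u} R} {i : ℕ}
    (hM : ∀ k, k + 1 = i → Subsingleton (Ext X (ModuleCat.of R M) k))
    (y : Ext X (ModuleCat.of R (LinearMap.ker f)) i)
    (hy : y.comp (Ext.mk₀ (ModuleCat.ofHom (LinearMap.ker f).subtype)) (add_zero i) = 0) :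
    y = 0 := by
  have hS := LinearMap.shortExact_shortComplexKer hf
  cases i with
  | zero =>
    have := hS.mono_f
    refine Ext.postcomp_mk₀_injective_of_mono X f.shortComplexKer.f ?_
    rw [map_zero]
    exact hy
  | succ k =>
    obtain ⟨z, rfl⟩ := Ext.covariant_sequence_exact₁ X hS y hy rfl
    have := (hM k rfl).elim z 0
    rw [this, Ext.zero_comp]

lemma IsExtSyzygy.ker {j : ℕ} {P M : Type u} [AddCommGroup P] [Module R P] [Module.Finite R P]
    [Module.Projective R P] [AddCommGroup M] [Module R M] {f : P →ₗ[R] M}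
    (hf : Function.Surjective f) (hM : IsExtSyzygy R j M) :
    IsExtSyzygy R (j + 1) (LinearMap.ker f) := by
  intro I d hd i hi
  refine subsingleton_of_forall_eq 0 fun y => ?_
  refine ext_postcomp_ker_subtype_eq_zero hf (fun k hk => hM I d hd k (by omega)) y ?_
  exact (subsingleton_ext_of_finite_projective P (hd i (by omega))).elim _ _

lemma IsExtSyzygy.extVanishesBelow {j : ℕ} {P M : Type u} [AddCommGroup P] [Module R P]
    [AddCommGroup M] [Module R M] {f : P →ₗ[R] M} (hf : Function.Surjective f)
    (hM : IsExtSyzygy R j M) {I : Ideal R} {e : LinearMap.ker f} {φ : LinearMap.ker f →ₗ[R] R}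
    {s : R} (hs : 1 - s * φ e ∈ I) {n : ℕ} {r : Fin n → R} {q : Fin n → P} (hr : ∀ i, r i ∈ I)
    (he : (e : P) = ∑ i, r i • q i) : ExtVanishesBelow I R (j + 1) := by
  suffices h : ∀ d ≤ j + 1, ExtVanishesBelow I R d from h _ le_rfl
  intro d
  induction d with
  | zero => exact fun _ i hi => absurd hi (by simp)
  | succ d ih =>
    intro hd i hi
    have hvan := ih (by omega)
    rcases Nat.lt_succ_iff_lt_or_eq.1 hi with hlt | rfl
    · exact hvan i hlt
    refine subsingleton_of_forall_eq 0 fun y => ?_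
    let e' := ModuleCat.ofHom (LinearMap.toSpanSingleton R (LinearMap.ker f) e)
    have hzero : y.comp (Ext.mk₀ e') (add_zero i) = 0 := by
      refine ext_postcomp_ker_subtype_eq_zero hf (fun k hk => hM I i hvan k (by omega)) _ ?_
      have hsum : e' ≫ ModuleCat.ofHom (LinearMap.ker f).subtype =
          ∑ a, r a • ModuleCat.ofHom (LinearMap.toSpanSingleton R P (q a)) := by
        ext
        simp [e', he]
      rw [Ext.comp_assoc_of_third_deg_zero, Ext.mk₀_comp_mk₀, hsum, Ext.mk₀_sum, Ext.comp_sum]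
      refine Finset.sum_eq_zero fun a _ => ?_
      rw [Ext.mk₀_smul, Ext.comp_smul]
      exact ext_smul_eq_zero_of_left (smul_id_quotient_eq_zero (hr a)) _
    have hφ : e' ≫ ModuleCat.ofHom φ = φ e • 𝟙 (ModuleCat.of R R) := by
      ext
      simp [e']
    have hφy : φ e • y = 0 := by
      rw [Ext.smul_eq_comp_mk₀, ← hφ, ← Ext.mk₀_comp_mk₀, ← Ext.comp_assoc_of_third_deg_zero,
        hzero, Ext.zero_comp]
    have h1 : (1 - s * φ e) • y = 0 :=
      ext_smul_eq_zero_of_left (smul_id_quotient_eq_zero hs) _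
    rwa [sub_smul, mul_smul, hφy, smul_zero, one_smul, sub_zero] at h1

/-- A resolution of `M` by finitely generated projectives can be shortened unless its length is
bounded by the grade of some maximal ideal. -/
lemma HasFPRLen.shorten_or_exists_maximal {n j : ℕ} {M : Type u} [AddCommGroup M] [Module R M]
    (h : HasFPRLen R (n + 1) M) (hM : IsExtSyzygy R j M) :
    HasFPRLen R n M ∨ ∃ m I : Ideal R, m.IsMaximal ∧ I.FG ∧ I ≤ m ∧
      ExtVanishesBelow I R (j + (n + 1)) := by
  induction n generalizing j M with
  | zero =>
    obtain ⟨P, _, _, f, _, _, hf, _, _⟩ := h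
    obtain ⟨g, hg⟩ | ⟨m, hm, e, φ, hφ, hψ⟩ :=
      exists_leftInverse_or_exists_maximal (LinearMap.ker f).subtype
    · left
      have hsplit : (Function.Injective (LinearMap.ker f).subtype ∧
            ∃ l, f ∘ₗ l = LinearMap.id) ↔
          (Function.Surjective f ∧ ∃ l, l ∘ₗ (LinearMap.ker f).subtype = LinearMap.id) :=
        (LinearMap.exact_subtype_ker_map f).split_tfae'.out 0 1
      obtain ⟨-, s, hs⟩ := hsplit.2 ⟨hf, g, hg⟩
      exact ⟨Module.Finite.of_surjective f hf, Module.Projective.of_split s f hs⟩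
    · right
      obtain ⟨k, q, ψ, hq⟩ := exists_dual_basis (R := R) P
      obtain ⟨s, a, ha, hsa⟩ := hm.exists_inv hφ
      have hle : Ideal.span (insert (1 - s * φ e) (Set.range fun i => ψ i e)) ≤ m := by
        refine Ideal.span_le.2 (Set.insert_subset ?_ ?_)
        · rw [← hsa, add_sub_cancel_left]
          exact ha
        · rintro _ ⟨i, rfl⟩
          exact hψ (ψ i)
      refine ⟨m, _, hm, Submodule.fg_span ((Set.finite_range _).insert _), hle, ?_⟩
      exact hM.extVanishesBelow hf (Ideal.subset_span (Set.mem_insert _ _))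
        (fun i => Ideal.subset_span (Set.mem_insert_of_mem _ ⟨i, rfl⟩)) (hq e).symm
  | succ n ih =>
    obtain ⟨P, _, _, f, hfin, hproj, hf, hker⟩ := h
    refine (ih hker (hM.ker hf)).imp (fun h' => ⟨P, _, _, f, hfin, hproj, hf, h'⟩) ?_
    rintro ⟨m, I, hm, hI, hIm, hv⟩
    exact ⟨m, I, hm, hI, hIm, by rwa [add_assoc, add_comm 1] at hv⟩

lemma HasFPR.projDim_le {M : Type u} [AddCommGroup M] [Module R M] (h : HasFPR R M) :
    projDim R M ≤ ⨆ (m : Ideal R) (_ : m.IsMaximal), idealGrade R m R := by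
  classical
  have hle : projDim R M ≤ Nat.find h := sInf_le ⟨_, rfl, (Nat.find_spec h).hasProjResLE⟩
  refine hle.trans ?_
  obtain hn | ⟨n, hn⟩ : Nat.find h = 0 ∨ ∃ n, Nat.find h = n + 1 := by
    cases Nat.find h <;> simp
  · simp [hn]
  · have hlen : HasFPRLen R (n + 1) M := hn ▸ Nat.find_spec h
    obtain h' | ⟨m, I, hm, hI, hIm, hv⟩ := hlen.shorten_or_exists_maximal IsExtSyzygy.zero
    · exact absurd h' (Nat.find_min h (by omega))
    · rw [zero_add, ← le_extGrade_iff] at hv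
      rw [hn]
      have hgrade : extGrade R I R ≤ idealGrade R m R :=
        le_iSup₂_of_le I hI (le_iSup (fun _ : I ≤ m => extGrade R I R) hIm)
      exact hv.trans (hgrade.trans
        (le_iSup₂ (f := fun (m : Ideal R) (_ : m.IsMaximal) => idealGrade R m R) m hm))

end FPDLeGrade

/-- The small finitistic dimension of `R` equals the supremum of the grades
`grade_R(𝔪, R)` over the maximal ideals `𝔪` of `R`. -/
theorem fPD_eq_sup_grade_of_maximal (R : Type u) [CommRing R] :
    fPD R = ⨆ (m : Ideal R) (_ : m.IsMaximal), idealGrade R m R := by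
  refine le_antisymm (iSup₂_le fun M hM => hM.projDim_le) ?_
  refine iSup₂_le fun m hm => iSup₂_le fun I hI => iSup_le fun hIm => ?_
  refine ENat.forall_natCast_le_iff_le.1 fun k hk => ?_
  exact le_fPD_of_extVanishesBelow hI hm hIm (le_extGrade_iff.1 hk)
end

section
/- Let D be an integral domain that is not a field and let Q be its quotient field. Then the trivial extension D(+)(Q/D) is a total ring of quotients, i.e., every non-zero-divisor of D(+)(Q/D) is a unit. -/
open CategoryTheory

universe u

/-- For a module over a commutative ring, the canonical right module structure. -/
noncomputable local instance moduleOpOfModule (R : Type u) [CommRing R] (M : Type u)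
    [AddCommGroup M] [Module R M] : Module Rᵐᵒᵖ M :=
  Module.compHom M ((RingHom.id R).fromOpposite mul_comm)

local instance isCentralScalarOfModule (R : Type u) [CommRing R] (M : Type u)
    [AddCommGroup M] [Module R M] : IsCentralScalar R M :=
  ⟨fun _ _ => rfl⟩

/-- An element of a trivial extension is a unit if its first component is. In contrast with
`TrivSqZeroExt.isUnit_iff_isUnit_fst`, the two actions need not come from module structures. -/
theorem isUnit_of_isUnit_fst {R M : Type*} [Monoid R] [AddGroup M] [DistribMulAction R M]
    [DistribMulAction Rᵐᵒᵖ M] [SMulCommClass R Rᵐᵒᵖ M] {x : TrivSqZeroExt R M}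
    (hx : IsUnit x.fst) : IsUnit x := by
  obtain ⟨u, hu⟩ := hx
  refine ⟨⟨x, (↑u⁻¹, -((↑u⁻¹ : R) • MulOpposite.op (↑u⁻¹ : R) • x.snd)), ?_, ?_⟩, rfl⟩
  · refine TrivSqZeroExt.ext ?_ ?_
    · change x.fst * ↑u⁻¹ = 1
      simp [← hu]
    · change x.fst • -((↑u⁻¹ : R) • MulOpposite.op (↑u⁻¹ : R) • x.snd) +
        MulOpposite.op (↑u⁻¹ : R) • x.snd = 0
      simp [← hu, smul_smul]
  · refine TrivSqZeroExt.ext ?_ ?_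
    · change ↑u⁻¹ * x.fst = 1
      simp [← hu]
    · change (↑u⁻¹ : R) • x.snd + MulOpposite.op x.fst •
        -((↑u⁻¹ : R) • MulOpposite.op (↑u⁻¹ : R) • x.snd) = 0
      rw [smul_neg, ← smul_comm, smul_smul (MulOpposite.op x.fst), ← MulOpposite.op_mul, ← hu]
      simp

/-- If `1 / a` vanishes in `Q / D` for some nonzero `a`, then `a` is a unit of `D`. -/
theorem isUnit_of_mkQ_inv_eq_zero {D : Type u} [CommRing D] [IsDomain D] {a : D} (ha : a ≠ 0)
    (h : (LinearMap.range (Algebra.linearMap D (FractionRing D))).mkQ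
      (algebraMap D (FractionRing D) a)⁻¹ = 0) : IsUnit a := by
  rw [Submodule.mkQ_apply, Submodule.Quotient.mk_eq_zero] at h
  obtain ⟨b, hb⟩ := h
  have ha' : algebraMap D (FractionRing D) a ≠ 0 := by simpa using ha
  refine IsUnit.of_mul_eq_one b (IsFractionRing.injective D (FractionRing D) ?_)
  rw [Algebra.linearMap_apply] at hb
  rw [map_mul, hb, map_one, mul_inv_cancel₀ ha']

/-- Every nonunit of a domain that is not a field kills a nonzero element of `Q / D`. -/
theorem exists_ne_zero_smul_eq_zero_of_not_isUnit {D : Type u} [CommRing D] [IsDomain D]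
    (hD : ¬ IsField D) {d : D} (hd : ¬ IsUnit d) :
    ∃ m : FractionRing D ⧸ LinearMap.range (Algebra.linearMap D (FractionRing D)),
      m ≠ 0 ∧ d • m = 0 := by
  by_cases hd0 : d = 0
  · obtain ⟨a, ha0, ha⟩ := Ring.exists_not_isUnit_of_not_isField hD
    exact ⟨_, fun h => ha (isUnit_of_mkQ_inv_eq_zero ha0 h), by rw [hd0, zero_smul]⟩
  · refine ⟨_, fun h => hd (isUnit_of_mkQ_inv_eq_zero hd0 h), ?_⟩
    have hd' : algebraMap D (FractionRing D) d ≠ 0 := by simpa using hd0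
    rw [← map_smul, Algebra.smul_def, mul_inv_cancel₀ hd', Submodule.mkQ_apply,
      Submodule.Quotient.mk_eq_zero]
    exact ⟨1, by simp⟩

/-- For a non-field domain `D` with quotient field `Q`, the trivial extension `D(+)(Q/D)`
is a total ring of quotients: every non-zero-divisor is a unit. -/
theorem trivSqZeroExt_isTotalRingOfQuotients (D : Type u) [CommRing D] [IsDomain D]
    (hD : ¬ IsField D) :
    ∀ x : TrivSqZeroExt D ((FractionRing D) ⧸ LinearMap.range (Algebra.linearMap D (FractionRing D))),
      x ∈ nonZeroDivisors (TrivSqZeroExt D ((FractionRing D) ⧸ LinearMap.range (Algebra.linearMap D (FractionRing D)))) → IsUnit x := by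
  intro x hx
  suffices hu : IsUnit x.fst from
    @isUnit_of_isUnit_fst D _ _ (Submodule.Quotient.addCommGroup _).toAddGroup _ _ _ x hu
  by_contra hd
  obtain ⟨m, hm, hdm⟩ := exists_ne_zero_smul_eq_zero_of_not_isUnit hD hd
  refine hm (TrivSqZeroExt.inr_injective (R := D) ?_)
  rw [TrivSqZeroExt.inr_zero]
  refine (mem_nonZeroDivisors_iff.1 hx).1 _ ?_
  ext
  · simp
  · simp [hdm]
end
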